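/- arXiv:1004.1571 — 5 statements merged into one kernel-verified Lean document; each statement's English description precedes it below -/
import Mathlib

section
/- Let E be a standard Borel space and let μ₁, μ₂ be probability measures on E. Then for every coupling ν of (μ₁, μ₂), one has ν({(a,b) ∈ E × E : a ≠ b}) ≥ 1 − (μ₁ ⊓ μ₂)(E), where μ₁ ⊓ μ₂ denotes the lattice infimum of the two measures. -/
open MeasureTheory

/-- Coupling lower bound: for any coupling `ν` of probability measures `μ₁, μ₂` on a
standard Borel space, `ν {a ≠ b} ≥ 1 - (μ₁ ⊓ μ₂)(E)`. -/
theorem stmt0 {E : Type*} [MeasurableSpace E] [StandardBorelSpace E]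
    (μ₁ μ₂ : Measure E) [IsProbabilityMeasure μ₁] [IsProbabilityMeasure μ₂]
    (ν : Measure (E × E)) [IsProbabilityMeasure ν]
    (h1 : ν.map Prod.fst = μ₁) (h2 : ν.map Prod.snd = μ₂) :
    1 - (μ₁ ⊓ μ₂) Set.univ ≤ ν {p : E × E | p.1 ≠ p.2} := by
  letI := upgradeStandardBorel E
  have hD : MeasurableSet {p : E × E | p.1 = p.2} :=
    measurableSet_eq_fun measurable_fst measurable_snd
  have e : (ν.restrict {p : E × E | p.1 = p.2}).map Prod.fst
      = (ν.restrict {p : E × E | p.1 = p.2}).map Prod.snd := by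
    apply Measure.map_congr
    filter_upwards [ae_restrict_mem hD] with p hp using hp
  have l1 : (ν.restrict {p : E × E | p.1 = p.2}).map Prod.fst ≤ μ₁ := by
    rw [← h1]
    exact Measure.map_mono Measure.restrict_le_self measurable_fst
  have l2 : (ν.restrict {p : E × E | p.1 = p.2}).map Prod.fst ≤ μ₂ := by
    rw [← h2, e]
    exact Measure.map_mono Measure.restrict_le_self measurable_snd
  have l := le_inf l1 l2 Set.univ
  rw [Measure.map_apply measurable_fst MeasurableSet.univ, Set.preimage_univ,
    Measure.restrict_apply_univ] at l
  have c : ν {p : E × E | p.1 ≠ p.2} = 1 - ν {p : E × E | p.1 = p.2} :=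
    prob_compl_eq_one_sub hD
  rw [c]
  exact tsub_le_tsub_left l 1
end

section
/- Let E be a standard Borel space and let μ₁, μ₂ be probability measures on E. Then there exists a coupling ν of (μ₁, μ₂) (a maximal coupling) such that for every measurable set Γ ⊆ E, ν({(a,b) ∈ E × E : a = b and a ∈ Γ}) = (μ₁ ⊓ μ₂)(Γ); in particular ν({(a,b) : a ≠ b}) = 1 − (μ₁ ⊓ μ₂)(E), so ν minimizes ν'({a ≠ b}) over all couplings ν' of (μ₁, μ₂). -/
open MeasureTheory

theorem coupling_diag_le {E : Type*} [MeasurableSpace E] [StandardBorelSpace E]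
    (μ₁ μ₂ : Measure E) (ν : Measure (E × E))
    (h1 : ν.map Prod.fst = μ₁) (h2 : ν.map Prod.snd = μ₂)
    (Γ : Set E) (hΓ : MeasurableSet Γ) :
    ν {p : E × E | p.1 = p.2 ∧ p.1 ∈ Γ} ≤ (μ₁ ⊓ μ₂) Γ := by
  have hD : MeasurableSet {p : E × E | p.1 = p.2} :=
    measurableSet_eq_fun measurable_fst measurable_snd
  have hle : (ν.restrict {p : E × E | p.1 = p.2}).map Prod.fst ≤ μ₁ ⊓ μ₂ := by
    refine le_inf ?_ ?_
    · rw [← h1]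
      exact Measure.map_mono Measure.restrict_le_self measurable_fst
    · have : (ν.restrict {p : E × E | p.1 = p.2}).map Prod.fst
          = (ν.restrict {p : E × E | p.1 = p.2}).map Prod.snd := by
        apply Measure.map_congr
        exact ae_restrict_mem hD
      rw [this, ← h2]
      exact Measure.map_mono Measure.restrict_le_self measurable_snd
  have h := hle Γ
  rw [Measure.map_apply measurable_fst hΓ, Measure.restrict_apply (measurable_fst hΓ)] at h
  refine le_trans (measure_mono ?_) h
  rintro p ⟨hp, hq⟩
  exact ⟨hq, hp⟩

theorem coupling_ne {E : Type*} [MeasurableSpace E] [StandardBorelSpace E]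
    (ν : Measure (E × E)) [IsProbabilityMeasure ν] :
    ν {p : E × E | p.1 ≠ p.2} = 1 - ν {p : E × E | p.1 = p.2 ∧ p.1 ∈ Set.univ} := by
  have hD : MeasurableSet {p : E × E | p.1 = p.2} :=
    measurableSet_eq_fun measurable_fst measurable_snd
  have := prob_compl_eq_one_sub (μ := ν) hD
  simpa [Set.compl_ofPred] using this

/-- Existence of a maximal coupling of two probability measures on a standard Borel
space: a coupling `ν` with `ν {a = b, a ∈ Γ} = (μ₁ ⊓ μ₂)(Γ)` for every measurable `Γ`;
in particular `ν {a ≠ b} = 1 - (μ₁ ⊓ μ₂)(E)`, which is minimal among all couplings. -/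
theorem stmt1 {E : Type*} [MeasurableSpace E] [StandardBorelSpace E]
    (μ₁ μ₂ : Measure E) [IsProbabilityMeasure μ₁] [IsProbabilityMeasure μ₂] :
    ∃ ν : Measure (E × E), IsProbabilityMeasure ν ∧
      ν.map Prod.fst = μ₁ ∧ ν.map Prod.snd = μ₂ ∧
      (∀ Γ : Set E, MeasurableSet Γ →
        ν {p : E × E | p.1 = p.2 ∧ p.1 ∈ Γ} = (μ₁ ⊓ μ₂) Γ) ∧
      ν {p : E × E | p.1 ≠ p.2} = 1 - (μ₁ ⊓ μ₂) Set.univ ∧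
      (∀ ν' : Measure (E × E), IsProbabilityMeasure ν' →
        ν'.map Prod.fst = μ₁ → ν'.map Prod.snd = μ₂ →
        ν {p : E × E | p.1 ≠ p.2} ≤ ν' {p : E × E | p.1 ≠ p.2}) := by
  set m := μ₁ ⊓ μ₂ with hm
  have hm1 : m ≤ μ₁ := inf_le_left
  have hm2 : m ≤ μ₂ := inf_le_right
  have : IsFiniteMeasure m := isFiniteMeasure_of_le μ₁ hm1
  set α := μ₁ - m with hα
  set β := μ₂ - m with hβ
  have ha : α + m = μ₁ := Measure.sub_add_cancel_of_le hm1
  have hb : β + m = μ₂ := Measure.sub_add_cancel_of_le hm2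
  have : IsFiniteMeasure α := isFiniteMeasure_of_le μ₁ Measure.sub_le
  have : IsFiniteMeasure β := isFiniteMeasure_of_le μ₂ Measure.sub_le
  have hab : α Set.univ = β Set.univ := by
    rw [hα, hβ, Measure.sub_apply MeasurableSet.univ hm1, Measure.sub_apply MeasurableSet.univ hm2,
      measure_univ (μ := μ₁), measure_univ (μ := μ₂)]
  have hdiag : Measurable (fun x : E => (x, x)) := measurable_id.prodMk measurable_id
  have hcan : ∀ γ : Measure E, γ Set.univ = α Set.univ →
      (α Set.univ)⁻¹ • (α Set.univ • γ) = γ := by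
    intro γ hγ
    by_cases h0 : α Set.univ = 0
    · have : γ = 0 := Measure.measure_univ_eq_zero.mp (hγ.trans h0)
      simp [this]
    · rw [smul_smul, ENNReal.inv_mul_cancel h0 (measure_ne_top _ _), one_smul]
  let ν : Measure (E × E) := m.map (fun x => (x, x)) + (α Set.univ)⁻¹ • α.prod β
  have h1 : ν.map Prod.fst = μ₁ := by
    rw [Measure.map_add _ _ measurable_fst, Measure.map_map measurable_fst hdiag,
      Measure.map_smul, Measure.map_fst_prod, ← hab, hcan α rfl, add_comm, ← ha]
    congr 1
    exact Measure.map_id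
  have h2 : ν.map Prod.snd = μ₂ := by
    rw [Measure.map_add _ _ measurable_snd, Measure.map_map measurable_snd hdiag,
      Measure.map_smul, Measure.map_snd_prod, hcan β hab.symm, add_comm, ← hb]
    congr 1
    exact Measure.map_id
  have hP : IsProbabilityMeasure ν := by
    constructor
    have : (ν.map Prod.fst) Set.univ = 1 := by rw [h1]; exact measure_univ
    rwa [Measure.map_apply measurable_fst MeasurableSet.univ, Set.preimage_univ] at this
  have hD : MeasurableSet {p : E × E | p.1 = p.2} :=
    measurableSet_eq_fun measurable_fst measurable_snd
  have hG : ∀ Γ : Set E, MeasurableSet Γ → ν {p : E × E | p.1 = p.2 ∧ p.1 ∈ Γ} = m Γ := by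
    intro Γ hΓ
    refine le_antisymm (coupling_diag_le μ₁ μ₂ ν h1 h2 Γ hΓ) ?_
    have hS : MeasurableSet {p : E × E | p.1 = p.2 ∧ p.1 ∈ Γ} := hD.inter (measurable_fst hΓ)
    have hle : m.map (fun x => (x, x)) ≤ ν := Measure.le_add_right le_rfl
    refine le_trans ?_ (hle _)
    rw [Measure.map_apply hdiag hS]
    exact measure_mono fun x hx => ⟨rfl, hx⟩
  refine ⟨ν, hP, h1, h2, hG, ?_, ?_⟩
  · rw [coupling_ne, hG _ MeasurableSet.univ]
  · intro ν' hP' h1' h2'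
    rw [coupling_ne, coupling_ne, hG _ MeasurableSet.univ]
    exact tsub_le_tsub_left (coupling_diag_le μ₁ μ₂ ν' h1' h2' _ MeasurableSet.univ) _
end

section
/- Let μ₁ and μ₂ be mutually absolutely continuous probability measures on a measurable space E, let p > 1 and C > 1, and suppose that ∫_E (dμ₂/dμ₁)^{p+1} dμ₁ ≤ C, where dμ₂/dμ₁ is the Radon–Nikodym derivative. Then (μ₁ ⊓ μ₂)(E) ≥ (1 − 1/p) · (1/(pC))^{1/(p−1)}, where μ₁ ⊓ μ₂ denotes the lattice infimum of the two measures. -/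
open MeasureTheory

/-- Quantitative overlap bound: if `μ₁, μ₂` are mutually absolutely continuous
probability measures with `∫ (dμ₂/dμ₁)^(p+1) dμ₁ ≤ C` for some `p > 1`, `C > 1`, then
`(μ₁ ⊓ μ₂)(E) ≥ (1 - 1/p) (1/(pC))^(1/(p-1))`. -/
theorem stmt2 {E : Type*} [MeasurableSpace E]
    (μ₁ μ₂ : Measure E) [IsProbabilityMeasure μ₁] [IsProbabilityMeasure μ₂]
    (hac₁ : μ₂ ≪ μ₁) (hac₂ : μ₁ ≪ μ₂)
    (p C : ℝ) (hp : 1 < p) (hC : 1 < C)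
    (hint : ∫⁻ x, μ₂.rnDeriv μ₁ x ^ (p + 1) ∂μ₁ ≤ ENNReal.ofReal C) :
    ENNReal.ofReal ((1 - 1 / p) * (1 / (p * C)) ^ (1 / (p - 1)))
      ≤ (μ₁ ⊓ μ₂) Set.univ := by
  set f := μ₂.rnDeriv μ₁ with hf
  have hfm : Measurable f := Measure.measurable_rnDeriv _ _
  have hfi : ∫⁻ x, f x ∂μ₁ = 1 := by
    rw [hf, Measure.lintegral_rnDeriv hac₁, measure_univ]
  have hle : μ₁.withDensity (fun x => min 1 (f x)) ≤ μ₁ ⊓ μ₂ := by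
    refine le_inf ?_ ?_
    · calc _ ≤ μ₁.withDensity 1 :=
            withDensity_mono (Filter.Eventually.of_forall fun x => min_le_left _ _)
        _ = μ₁ := withDensity_one
    · calc _ ≤ μ₁.withDensity f :=
            withDensity_mono (Filter.Eventually.of_forall fun x => min_le_right _ _)
        _ = μ₂ := Measure.withDensity_rnDeriv_eq _ _ hac₁
  refine le_trans ?_ (hle Set.univ)
  rw [withDensity_apply _ MeasurableSet.univ, Measure.restrict_univ]
  have hpC : 1 < p * C := by nlinarith
  have hb0 : 0 < 1 / (p * C) := by positivity
  have hb1 : 1 / (p * C) ≤ 1 := by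
    rw [div_le_one (by linarith)]; exact hpC.le
  set t : ℝ := (1 / (p * C)) ^ (1 / (p - 1)) with ht
  have ht0 : 0 < t := Real.rpow_pos_of_pos hb0 _
  have ht1 : t ≤ 1 := Real.rpow_le_one hb0.le hb1 (by
    have : 0 < p - 1 := by linarith
    positivity)
  have htp : t ^ (p - 1) = 1 / (p * C) := by
    rw [ht, ← Real.rpow_mul hb0.le, one_div_mul_cancel (by linarith), Real.rpow_one]
  have htp1 : t ^ (p + 1) * C ≤ t / p := by
    have e : t ^ (p + 1) = t ^ (p - 1) * t * t := by
      rw [show p + 1 = (p - 1) + 1 + 1 by ring, Real.rpow_add_one ht0.ne',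
        Real.rpow_add_one ht0.ne']
    rw [e, htp]
    have : 1 / (p * C) * t * t * C = t * t / p := by field_simp
    rw [this]
    gcongr
    nlinarith
  have key : ∀ x, ENNReal.ofReal t * f x
      ≤ min 1 (f x) + ENNReal.ofReal (t ^ (p + 1)) * f x ^ (p + 1) := by
    intro x
    rw [← ENNReal.ofReal_rpow_of_pos ht0, ← ENNReal.mul_rpow_of_nonneg _ _ (by linarith)]
    rcases le_total (ENNReal.ofReal t * f x) 1 with h | h
    · refine le_add_right (le_min h ?_)
      exact mul_le_of_le_one_left' (ENNReal.ofReal_le_one.2 ht1)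
    · refine le_add_left ?_
      conv_lhs => rw [← ENNReal.rpow_one (ENNReal.ofReal t * f x)]
      exact ENNReal.rpow_le_rpow_of_exponent_le h (by linarith)
  have h1 := lintegral_mono (μ := μ₁) key
  rw [lintegral_const_mul _ hfm, hfi, mul_one, lintegral_add_left (measurable_const.min hfm),
    lintegral_const_mul _ (hfm.pow_const _)] at h1
  have h2 : ENNReal.ofReal (t ^ (p + 1)) * ∫⁻ x, f x ^ (p + 1) ∂μ₁ ≤ ENNReal.ofReal (t / p) := by
    calc _ ≤ ENNReal.ofReal (t ^ (p + 1)) * ENNReal.ofReal C := by gcongr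
      _ = ENNReal.ofReal (t ^ (p + 1) * C) := (ENNReal.ofReal_mul (by positivity)).symm
      _ ≤ _ := ENNReal.ofReal_le_ofReal htp1
  have h3 : (1 - 1 / p) * t = t - t / p := by ring
  rw [h3, ENNReal.ofReal_sub _ (by positivity), tsub_le_iff_right]
  exact h1.trans (by gcongr)
end

section
/- Let H and Ξ be real separable Hilbert spaces, let l > 0, and let ψ : H × Ξ → ℝ be continuous and such that |ψ(x,z) − ψ(x,z')| ≤ l‖z − z'‖ for all x ∈ H and z, z' ∈ Ξ. Let ζ, ζ' : H → Ξ be continuous from the norm topology of H to the weak topology of Ξ and of polynomial growth: there exist c > 0 and q ≥ 1 with ‖ζ(x)‖ ≤ c(1 + ‖x‖^q) and ‖ζ'(x)‖ ≤ c(1 + ‖x‖^q) for all x. Define Υ̃ : H → Ξ by Υ̃(x) = ((ψ(x,ζ(x)) − ψ(x,ζ'(x)))/‖ζ(x) − ζ'(x)‖²) · (ζ(x) − ζ'(x)) if ζ(x) ≠ ζ'(x), and Υ̃(x) = 0 if ζ(x) = ζ'(x). Then there exists a sequence (Υ̃ₙ)ₙ of Lipschitz functions H → Ξ which is uniformly bounded,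 i.e. supₙ sup_{x∈H} ‖Υ̃ₙ(x)‖ < ∞, and such that Υ̃ₙ(x) → Υ̃(x) in the norm of Ξ for every x ∈ H. -/
open scoped Classical

namespace Aux

open Filter Topology

def Lip {H E : Type*} [PseudoMetricSpace H] [PseudoMetricSpace E] (f : H → E) : Prop :=
  ∃ K : NNReal, LipschitzWith K f

def B1 {H E : Type*} [TopologicalSpace H] [TopologicalSpace E] (f : H → E) : Prop :=
  ∃ u : ℕ → H → E, (∀ n, Continuous (u n)) ∧ ∀ x, Tendsto (fun n => u n x) atTop (𝓝 (f x))

lemma Lip.smul {H E : Type*} [PseudoMetricSpace H] [NormedAddCommGroup E] [NormedSpace ℝ E]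
    {a : H → ℝ} {b : H → E} (ha : Lip a) (hb : Lip b) (A B : ℝ)
    (hA : ∀ x, |a x| ≤ A) (hB : ∀ x, ‖b x‖ ≤ B) : Lip (fun x => a x • b x) := by
  obtain ⟨K, hK⟩ := ha
  obtain ⟨L, hL⟩ := hb
  refine ⟨_, LipschitzWith.of_dist_le' (K := A * L + K * B) fun x y => ?_⟩
  have h1 := hK.dist_le_mul x y
  have h2 := hL.dist_le_mul x y
  rw [dist_eq_norm] at h1 h2 ⊢
  have e : a x • b x - a y • b y = a x • (b x - b y) + (a x - a y) • b y := by
    rw [smul_sub, sub_smul]; abel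
  rw [e]
  refine (norm_add_le _ _).trans ?_
  rw [norm_smul, norm_smul]
  have hx := hA x
  have hA0 : 0 ≤ A := (abs_nonneg _).trans hx
  have h3 : ‖a x‖ * ‖b x - b y‖ ≤ A * (L * dist x y) :=
    mul_le_mul hx h2 (norm_nonneg _) hA0
  have h4 : ‖a x - a y‖ * ‖b y‖ ≤ (K * dist x y) * B :=
    mul_le_mul h1 (hB y) (norm_nonneg _) (by positivity)
  linarith

lemma Lip.sum {H E ι : Type*} [PseudoMetricSpace H] [NormedAddCommGroup E]
    (s : Finset ι) {f : ι → H → E} (h : ∀ i, Lip (f i)) : Lip (fun x => ∑ i ∈ s, f i x) := by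
  classical
  induction s using Finset.induction_on with
  | empty => exact ⟨0, by simpa using LipschitzWith.const (0 : E)⟩
  | insert a s ha ih =>
    obtain ⟨K, hK⟩ := ih
    obtain ⟨L, hL⟩ := h a
    refine ⟨L + K, ?_⟩
    simp only [Finset.sum_insert ha]
    exact hL.add hK

/-- cutoff -/
noncomputable def phi {H : Type*} [PseudoMetricSpace H] (C : ℕ → Set H) (n k : ℕ) (x : H) : ℝ :=
  max 0 (1 - n * Metric.infDist x (C k))

noncomputable def P {H : Type*} [PseudoMetricSpace H] (C : ℕ → Set H) (n k : ℕ) (x : H) : ℝ :=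
  ∏ j ∈ Finset.range k, (1 - phi C n j x)

section
variable {H : Type*} [PseudoMetricSpace H] (C : ℕ → Set H)

lemma phi_nonneg (n k : ℕ) (x : H) : 0 ≤ phi C n k x := le_max_left _ _

lemma phi_le (n k : ℕ) (x : H) : phi C n k x ≤ 1 := by
  refine max_le zero_le_one ?_
  have : 0 ≤ (n : ℝ) * Metric.infDist x (C k) := mul_nonneg n.cast_nonneg Metric.infDist_nonneg
  linarith

lemma phi_lip (n k : ℕ) : Lip (phi C n k) := by
  refine ⟨_, LipschitzWith.of_dist_le' (K := n) fun x y => ?_⟩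
  have h := (Metric.lipschitz_infDist_pt (C k)).dist_le_mul x y
  rw [Real.dist_eq] at h ⊢
  unfold phi
  refine (abs_max_sub_max_le_max _ _ _ _).trans ?_
  simp only [sub_self, abs_zero]
  refine max_le (by positivity) ?_
  have : (1 - n * Metric.infDist x (C k)) - (1 - n * Metric.infDist y (C k))
      = -(n * (Metric.infDist x (C k) - Metric.infDist y (C k))) := by ring
  rw [this, abs_neg, abs_mul, Nat.abs_cast]
  gcongr
  simpa using h

lemma P_succ (n k : ℕ) (x : H) : P C n (k+1) x = P C n k x * (1 - phi C n k x) :=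
  Finset.prod_range_succ _ _

lemma P_mem (n k : ℕ) (x : H) : 0 ≤ P C n k x ∧ P C n k x ≤ 1 := by
  constructor
  · exact Finset.prod_nonneg fun j _ => by linarith [phi_le C n j x]
  · exact Finset.prod_le_one (fun j _ => by linarith [phi_le C n j x])
      (fun j _ => by linarith [phi_nonneg C n j x])

lemma one_sub_lip {a : H → ℝ} (h : Lip a) : Lip (fun x => 1 - a x) := by
  obtain ⟨K, hK⟩ := h
  exact ⟨0 + K, (LipschitzWith.const (1:ℝ)).sub hK⟩

lemma P_lip (n k : ℕ) : Lip (P C n k) := by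
  induction k with
  | zero => exact ⟨0, by unfold P; simpa using LipschitzWith.const (1 : ℝ)⟩
  | succ k ih =>
    have : P C n (k+1) = fun x => P C n k x • (1 - phi C n k x) := by
      ext x; rw [P_succ]; rfl
    rw [this]
    refine ih.smul (one_sub_lip (phi_lip C n k)) 1 1 (fun x => ?_) (fun x => ?_)
    · rw [abs_of_nonneg (P_mem C n k x).1]; exact (P_mem C n k x).2
    · rw [Real.norm_eq_abs, abs_of_nonneg (by linarith [phi_le C n k x])]
      linarith [phi_nonneg C n k x]

noncomputable def W (n k : ℕ) (x : H) : ℝ := P C n k x * phi C n k x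

lemma W_nonneg (n k : ℕ) (x : H) : 0 ≤ W C n k x :=
  mul_nonneg (P_mem C n k x).1 (phi_nonneg C n k x)

lemma W_le (n k : ℕ) (x : H) : W C n k x ≤ 1 :=
  mul_le_one₀ (P_mem C n k x).2 (phi_nonneg C n k x) (phi_le C n k x)

lemma W_lip (n k : ℕ) : Lip (W C n k) := by
  refine (P_lip C n k).smul (phi_lip C n k) 1 1 (fun x => ?_) (fun x => ?_)
  · rw [abs_of_nonneg (P_mem C n k x).1]; exact (P_mem C n k x).2
  · rw [Real.norm_eq_abs, abs_of_nonneg (phi_nonneg C n k x)]; exact phi_le C n k x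

lemma W_sum (n m : ℕ) (x : H) : ∑ k ∈ Finset.range m, W C n k x = 1 - P C n m x := by
  induction m with
  | zero => simp [P]
  | succ m ih => rw [Finset.sum_range_succ, ih, P_succ, W]; ring

end

lemma glue {H E : Type*} [PseudoMetricSpace H] [NormedAddCommGroup E] [NormedSpace ℝ E]
    (C : ℕ → Set H) (hC : ∀ k, IsClosed (C k)) (hne : ∀ k, (C k).Nonempty)
    (hcov : ∀ x, ∃ k, x ∈ C k) (v : ℕ → E) (M : ℝ) (hv : ∀ k, ‖v k‖ ≤ M) :
    ∃ (g : ℕ → H → E) (i : H → ℕ), (∀ n, Lip (g n)) ∧ (∀ n x, ‖g n x‖ ≤ M) ∧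
      (∀ x, x ∈ C (i x)) ∧ ∀ x, Tendsto (fun n => g n x) atTop (𝓝 (v (i x))) := by
  have hM : 0 ≤ M := (norm_nonneg _).trans (hv 0)
  refine ⟨fun n x => ∑ k ∈ Finset.range n, W C n k x • v k, fun x => Nat.find (hcov x),
    fun n => ?_, fun n x => ?_, fun x => Nat.find_spec (hcov x), fun x => ?_⟩
  · refine Lip.sum _ fun k => ?_
    refine (W_lip C n k).smul ⟨0, LipschitzWith.const (v k)⟩ 1 M (fun x => ?_) (fun x => hv k)
    rw [abs_of_nonneg (W_nonneg C n k x)]; exact W_le C n k x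
  · calc ‖∑ k ∈ Finset.range n, W C n k x • v k‖
        ≤ ∑ k ∈ Finset.range n, W C n k x * M := by
          refine norm_sum_le_of_le _ fun k _ => ?_
          rw [norm_smul, Real.norm_eq_abs, abs_of_nonneg (W_nonneg C n k x)]
          exact mul_le_mul_of_nonneg_left (hv k) (W_nonneg C n k x)
      _ = (1 - P C n n x) * M := by rw [← Finset.sum_mul, W_sum]
      _ ≤ M := by nlinarith [(P_mem C n n x).1]
  · set k0 := Nat.find (hcov x) with hk0
    have hmem : x ∈ C k0 := Nat.find_spec (hcov x)
    have hphi1 : ∀ n, phi C n k0 x = 1 := fun n => by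
      simp [phi, Metric.infDist_zero_of_mem hmem]
    have hev : ∀ᶠ n : ℕ in atTop, ∀ j ∈ Finset.range k0, phi C n j x = 0 := by
      rw [Filter.eventually_all_finset]
      intro j hj
      have hj' : x ∉ C j := Nat.find_min (hcov x) (Finset.mem_range.1 hj)
      have hpos : 0 < Metric.infDist x (C j) :=
        ((hC j).notMem_iff_infDist_pos (hne j)).1 hj'
      obtain ⟨N, hN⟩ := exists_nat_gt (1 / Metric.infDist x (C j))
      filter_upwards [eventually_ge_atTop N] with n hn
      have : (N : ℝ) ≤ n := by exact_mod_cast hn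
      have h2 : 1 / Metric.infDist x (C j) < n := by linarith
      rw [div_lt_iff₀ hpos] at h2
      exact max_eq_left (by linarith)
    refine tendsto_const_nhds.congr' ?_
    filter_upwards [hev, eventually_gt_atTop k0] with n hn hnk
    have hP : P C n k0 x = 1 := Finset.prod_eq_one fun j hj => by rw [hn j hj, sub_zero]
    rw [Finset.sum_eq_single k0]
    · rw [W, hP, hphi1, one_mul, one_smul]
    · intro k _ hk
      rcases lt_or_gt_of_ne hk with h | h
      · rw [W, hn k (Finset.mem_range.2 h)]; simp
      · have : P C n k x = 0 :=
          Finset.prod_eq_zero (Finset.mem_range.2 h) (by rw [hphi1, sub_self])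
        rw [W, this]; simp
    · intro h; exact absurd (Finset.mem_range.2 hnk) h

lemma step {H E : Type*} [PseudoMetricSpace H] [Nonempty H] [NormedAddCommGroup E]
    [NormedSpace ℝ E] [SecondCountableTopology E] (B : ℝ) (hB : 0 < B) (f : H → E) (hf : B1 f)
    (hfB : ∀ x, ‖f x‖ ≤ B) :
    ∃ (g : ℕ → H → E) (s : H → E), (∀ n, Lip (g n)) ∧ (∀ n x, ‖g n x‖ ≤ 2 * B) ∧
      (∀ x, Tendsto (fun n => g n x) atTop (𝓝 (s x))) ∧ B1 (fun x => f x - s x) ∧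
      ∀ x, ‖f x - s x‖ ≤ B / 2 := by
  obtain ⟨u, hu, hlim⟩ := hf
  let v := TopologicalSpace.denseSeq E
  let D : ℕ × ℕ → Set H := fun p => {x | ∀ n, p.1 ≤ n → ‖u n x - v p.2‖ ≤ B / 2}
  have hDc : ∀ p, IsClosed (D p) := fun p => by
    have : D p = ⋂ n, ⋂ (_ : p.1 ≤ n), {x | ‖u n x - v p.2‖ ≤ B / 2} := by
      ext x; simp [D]
    rw [this]
    exact isClosed_iInter fun n => isClosed_iInter fun _ =>
      isClosed_le ((hu n).sub continuous_const).norm continuous_const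
  have hDv : ∀ p x, x ∈ D p → ‖f x - v p.2‖ ≤ B / 2 := fun p x hx => by
    refine le_of_tendsto ((hlim x).sub_const (v p.2)).norm ?_
    filter_upwards [eventually_ge_atTop p.1] with n hn using hx n hn
  have hcov : ∀ x, ∃ p, x ∈ D p := fun x => by
    obtain ⟨k, hk⟩ := (TopologicalSpace.denseRange_denseSeq E).exists_dist_lt (f x) (half_pos hB)
    rw [dist_eq_norm] at hk
    have := ((hlim x).sub_const (v k)).norm.eventually (gt_mem_nhds hk)
    obtain ⟨N, hN⟩ := eventually_atTop.1 this
    exact ⟨(N, k), fun n hn => (hN n hn).le⟩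
  let I := {p : ℕ × ℕ // (D p).Nonempty}
  have : Nonempty I := by
    obtain ⟨x⟩ := ‹Nonempty H›
    obtain ⟨p, hp⟩ := hcov x
    exact ⟨⟨p, x, hp⟩⟩
  obtain ⟨e, he⟩ := exists_surjective_nat I
  obtain ⟨g, i, h1, h2, h3, h4⟩ := glue (fun k => D (e k).1) (fun k => hDc _) (fun k => (e k).2)
    (fun x => by
      obtain ⟨p, hp⟩ := hcov x
      obtain ⟨k, hk⟩ := he ⟨p, x, hp⟩
      exact ⟨k, by rw [hk]; exact hp⟩)
    (fun k => v (e k).1.2) (2 * B) (fun k => by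
      obtain ⟨x, hx⟩ := (e k).2
      have a := hDv _ x hx
      have b := hfB x
      have c : ‖v (e k).1.2‖ ≤ ‖f x‖ + ‖f x - v (e k).1.2‖ := by
        rw [norm_sub_rev]; exact norm_le_insert' _ _
      linarith)
  refine ⟨g, fun x => v (e (i x)).1.2, h1, h2, h4, ⟨fun n x => u n x - g n x, fun n => ?_,
    fun x => (hlim x).sub (h4 x)⟩, fun x => hDv _ x (h3 x)⟩
  obtain ⟨K, hK⟩ := h1 n
  exact (hu n).sub hK.continuous

lemma main {H E : Type*} [PseudoMetricSpace H] [Nonempty H] [NormedAddCommGroup E]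
    [NormedSpace ℝ E] [CompleteSpace E] [SecondCountableTopology E] (B : ℝ) (hB : 0 < B)
    (f : H → E) (hf : B1 f) (hfB : ∀ x, ‖f x‖ ≤ B) :
    ∃ g : ℕ → H → E, (∀ n, Lip (g n)) ∧ (∃ M : ℝ, ∀ n x, ‖g n x‖ ≤ M) ∧
      ∀ x, Tendsto (fun n => g n x) atTop (𝓝 (f x)) := by
  let S : ℕ → Type _ := fun m => {f : H → E // B1 f ∧ ∀ x, ‖f x‖ ≤ B / 2 ^ m}
  have hs : ∀ m (f : S m), ∃ (g : ℕ → H → E) (s : H → E) (f' : S (m+1)), (∀ n, Lip (g n)) ∧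
      (∀ n x, ‖g n x‖ ≤ 2 * (B / 2 ^ m)) ∧
      (∀ x, Tendsto (fun n => g n x) atTop (𝓝 (s x))) ∧ ∀ x, f'.1 x = f.1 x - s x := by
    intro m f
    obtain ⟨g, s, h1, h2, h3, h4, h5⟩ := step (B / 2 ^ m) (by positivity) f.1 f.2.1 f.2.2
    refine ⟨g, s, ⟨fun x => f.1 x - s x, h4, fun x => (h5 x).trans (le_of_eq ?_)⟩, h1, h2, h3,
      fun x => rfl⟩
    rw [pow_succ]; field_simp
  choose g s f' h1 h2 h3 h4 using hs
  let F : ∀ m, S m := fun m =>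
    Nat.rec (motive := S) ⟨f, hf, by simpa using hfB⟩ (fun m f => f' m f) m
  have hF0 : ∀ x, (F 0).1 x = f x := fun x => rfl
  have hFs : ∀ m x, (F (m+1)).1 x = (F m).1 x - s m (F m) x := fun m x => h4 m (F m) x
  have hgeo : Summable fun m : ℕ => 2 * (B / 2 ^ m) := by
    have := (summable_geometric_two.mul_left (2 * B))
    refine this.congr fun m => ?_
    rw [div_pow, one_pow]; ring
  have hsb : ∀ m x, ‖s m (F m) x‖ ≤ 2 * (B / 2 ^ m) := fun m x =>
    le_of_tendsto (h3 m (F m) x).norm (Eventually.of_forall fun n => h2 m (F m) n x)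
  have hsum : ∀ x, ∑' m, s m (F m) x = f x := by
    intro x
    have hsn : Summable fun m => ‖s m (F m) x‖ :=
      Summable.of_nonneg_of_le (fun _ => norm_nonneg _) (fun m => hsb m x) hgeo
    refine HasSum.tsum_eq ((hasSum_iff_tendsto_nat_of_summable_norm hsn).2 ?_)
    have e : ∀ n, ∑ m ∈ Finset.range n, s m (F m) x = f x - (F n).1 x := by
      intro n
      induction n with
      | zero => simp [hF0]
      | succ n ih => rw [Finset.sum_range_succ, ih, hFs]; abel
    simp only [e]
    have : Tendsto (fun n => (F n).1 x) atTop (𝓝 0) := by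
      refine squeeze_zero_norm (fun n => (F n).2.2 x) ?_
      have := hgeo.tendsto_atTop_zero.const_mul (1/2)
      simpa using this
    simpa using this.const_sub (f x)
  refine ⟨fun n x => ∑ m ∈ Finset.range n, g m (F m) n x, fun n => Lip.sum _ fun m => h1 m _ n,
    ⟨∑' m : ℕ, 2 * (B / 2 ^ m), fun n x => ?_⟩, fun x => ?_⟩
  · refine (norm_sum_le_of_le _ fun m _ => h2 m (F m) n x).trans ?_
    exact hgeo.sum_le_tsum _ fun m _ => by positivity
  · rw [← hsum x]
    have := tendsto_tsum_of_dominated_convergence (𝓕 := atTop)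
      (f := fun n m => if m < n then g m (F m) n x else 0)
      (g := fun m => s m (F m) x) hgeo (fun m => ?_) (Eventually.of_forall fun n m => ?_)
    · refine this.congr fun n => ?_
      rw [tsum_eq_sum (s := Finset.range n)]
      · exact Finset.sum_congr rfl fun m hm => if_pos (Finset.mem_range.1 hm)
      · intro m hm
        exact if_neg (by simpa using hm)
    · refine (h3 m (F m) x).congr' ?_
      filter_upwards [eventually_gt_atTop m] with n hn
      rw [if_pos hn]
    · split_ifs
      · exact h2 m (F m) n x
      · rw [norm_zero]; positivity

lemma proj {E : Type*} [NormedAddCommGroup E] [InnerProductSpace ℝ E] [CompleteSpace E]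
    [SecondCountableTopology E] : ∃ Q : ℕ → E → E,
      (∀ z, Tendsto (fun n => Q n z) atTop (𝓝 z)) ∧
      ∀ n (H : Type _) [TopologicalSpace H] (ζ : H → E),
        (∀ y : E, Continuous fun x => (inner ℝ (ζ x) y : ℝ)) → Continuous fun x => Q n (ζ x) := by
  let v := TopologicalSpace.denseSeq E
  let U : ℕ → Submodule ℝ E := fun n => Submodule.span ℝ (v '' Set.Iio n)
  have hfd : ∀ n, FiniteDimensional ℝ (U n) := fun n =>
    FiniteDimensional.span_of_finite ℝ ((Set.finite_Iio n).image v)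
  refine ⟨fun n => (U n).starProjection, fun z => ?_, fun n H _ ζ hζ => ?_⟩
  · refine Submodule.starProjection_tendsto_self U ?_ z ?_
    · intro a b hab
      exact Submodule.span_mono (Set.image_mono (Set.Iio_subset_Iio hab))
    · intro y _
      have hsub : Set.range v ⊆ ((⨆ n, U n : Submodule ℝ E) : Set E) := by
        rintro _ ⟨k, rfl⟩
        exact (le_iSup U (k+1)) (Submodule.subset_span ⟨k, by simp, rfl⟩)
      exact closure_mono hsub (TopologicalSpace.denseRange_denseSeq E y)
  · have b := stdOrthonormalBasis ℝ (U n)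
    simp only [b.starProjection_eq_sum_rankOne, ContinuousLinearMap.sum_apply,
      InnerProductSpace.rankOne_apply]
    refine continuous_finset_sum _ fun i _ => Continuous.smul ?_ continuous_const
    simpa only [real_inner_comm] using hζ (b i)

end Aux


/-- Lemma 3.5: the measurable "linearization" vector field `Υ̃` built from a Lipschitz
Hamiltonian `ψ` and two weakly continuous fields `ζ, ζ'` of polynomial growth is the
pointwise limit of a uniformly bounded sequence of Lipschitz functions. -/
theorem stmt3 {H Ξ : Type*}
    [NormedAddCommGroup H] [InnerProductSpace ℝ H] [CompleteSpace H]
    [SecondCountableTopology H]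
    [NormedAddCommGroup Ξ] [InnerProductSpace ℝ Ξ] [CompleteSpace Ξ]
    [SecondCountableTopology Ξ]
    (l : ℝ) (hl : 0 < l)
    (ψ : H → Ξ → ℝ) (hψcont : Continuous fun p : H × Ξ => ψ p.1 p.2)
    (hψlip : ∀ (x : H) (z z' : Ξ), |ψ x z - ψ x z'| ≤ l * ‖z - z'‖)
    (ζ ζ' : H → Ξ)
    (hζweak : ∀ y : Ξ, Continuous fun x => (inner ℝ (ζ x) y : ℝ))
    (hζ'weak : ∀ y : Ξ, Continuous fun x => (inner ℝ (ζ' x) y : ℝ))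
    (c q : ℝ) (hc : 0 < c) (hq : 1 ≤ q)
    (hζgrowth : ∀ x : H, ‖ζ x‖ ≤ c * (1 + ‖x‖ ^ q))
    (hζ'growth : ∀ x : H, ‖ζ' x‖ ≤ c * (1 + ‖x‖ ^ q))
    (Υ : H → Ξ)
    (hΥ : ∀ x : H, Υ x =
      if ζ x = ζ' x then 0
      else ((ψ x (ζ x) - ψ x (ζ' x)) / ‖ζ x - ζ' x‖ ^ 2) • (ζ x - ζ' x)) :
    ∃ Υn : ℕ → H → Ξ,
      (∀ n, ∃ K : NNReal, LipschitzWith K (Υn n)) ∧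
      (∃ B : ℝ, ∀ n x, ‖Υn n x‖ ≤ B) ∧
      (∀ x : H, Filter.Tendsto (fun n => Υn n x) Filter.atTop (nhds (Υ x))) := by
  obtain ⟨Q, hQ, hQc⟩ := Aux.proj (E := Ξ)
  have key : ∀ (x : H) (z z' : Ξ) (ε : ℝ), 0 ≤ ε →
      ‖((ψ x z - ψ x z') / (‖z - z'‖ ^ 2 + ε)) • (z - z')‖ ≤ l := by
    intro x z z' ε hε
    by_cases h0 : z - z' = 0
    · rw [h0, smul_zero, norm_zero]; exact hl.le
    have hp : 0 < ‖z - z'‖ := norm_pos_iff.2 h0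
    rw [norm_smul, Real.norm_eq_abs, abs_div, abs_of_nonneg (a := ‖z - z'‖ ^ 2 + ε) (by positivity),
      div_mul_eq_mul_div, div_le_iff₀ (by positivity)]
    nlinarith [mul_le_mul_of_nonneg_right (hψlip x z z') hp.le, mul_nonneg hl.le hε]
  refine Aux.main l hl Υ ⟨fun n x =>
    ((ψ x (Q n (ζ x)) - ψ x (Q n (ζ' x))) /
      (‖Q n (ζ x) - Q n (ζ' x)‖ ^ 2 + 1 / ((n : ℝ) + 1))) • (Q n (ζ x) - Q n (ζ' x)),
    fun n => ?_, fun x => ?_⟩ (fun x => ?_)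
  · have c1 := hQc n H ζ hζweak
    have c2 := hQc n H ζ' hζ'weak
    have d1 := hψcont.comp (continuous_id.prodMk c1)
    have d2 := hψcont.comp (continuous_id.prodMk c2)
    refine Continuous.smul (Continuous.div (d1.sub d2)
      (((c1.sub c2).norm.pow 2).add continuous_const) fun x => ?_) (c1.sub c2)
    positivity
  · rw [hΥ x]
    split_ifs with h
    · simp [h]
    · have hne : ‖ζ x - ζ' x‖ ^ 2 + 0 ≠ 0 := by
        have := norm_pos_iff.2 (sub_ne_zero.2 h)
        positivity
      have t1 := hQ (ζ x)
      have t2 := hQ (ζ' x)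
      have p1 := ((hψcont.tendsto (x, ζ x)).comp (tendsto_const_nhds.prodMk_nhds t1))
      have p2 := ((hψcont.tendsto (x, ζ' x)).comp (tendsto_const_nhds.prodMk_nhds t2))
      have := ((p1.sub p2).div ((((t1.sub t2).norm.pow 2)).add
        (tendsto_one_div_add_atTop_nhds_zero_nat (𝕜 := ℝ))) hne).smul (t1.sub t2)
      simpa using this
  · rw [hΥ x]
    split_ifs with h
    · rw [norm_zero]; exact hl.le
    · simpa using key x (ζ x) (ζ' x) 0 le_rfl
end

section
/- Let (Ω, F, P) be a probability space, q ∈ (0,1), η > 0, K > 0, c > 0. Let ℓ₀ : Ω → ℕ be a measurable random variable with P(ℓ₀ ≥ l) ≤ q^l for all l ∈ ℕ, and let (M_l)_{l∈ℕ} be a sequence of nonnegative measurable random variables with E[e^{η M_l}] ≤ K c^l for all l. Then for every γ with 0 < γ < η such that ρ := q^{1−γ/η} c^{γ/η} < 1, the random variable ω ↦ M_{ℓ₀(ω)}(ω) satisfies E[e^{γ M_{ℓ₀}}] ≤ K^{γ/η} / (1 − ρ). -/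
open MeasureTheory

/-- Interpolation (Hölder) lemma for stopped exponential moments: if
`P(ℓ₀ ≥ l) ≤ q^l` and `E[e^{η M_l}] ≤ K c^l`, then for `0 < γ < η` with
`ρ = q^{1-γ/η} c^{γ/η} < 1` one has `E[e^{γ M_{ℓ₀}}] ≤ K^{γ/η} / (1 - ρ)`. -/
theorem stmt7 {Ω : Type*} [MeasurableSpace Ω] (P : Measure Ω) [IsProbabilityMeasure P]
    (q η K c : ℝ) (hq : q ∈ Set.Ioo (0 : ℝ) 1) (hη : 0 < η) (hK : 0 < K) (hc : 0 < c)
    (ℓ₀ : Ω → ℕ) (hℓ₀meas : Measurable ℓ₀)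
    (hℓ₀tail : ∀ l : ℕ, P {ω | l ≤ ℓ₀ ω} ≤ ENNReal.ofReal (q ^ l))
    (M : ℕ → Ω → ℝ) (hMmeas : ∀ l, Measurable (M l)) (hMnonneg : ∀ l ω, 0 ≤ M l ω)
    (hMexp : ∀ l : ℕ,
      ∫⁻ ω, ENNReal.ofReal (Real.exp (η * M l ω)) ∂P ≤ ENNReal.ofReal (K * c ^ l))
    (γ : ℝ) (hγ : 0 < γ) (hγη : γ < η)
    (hρ : q ^ (1 - γ / η) * c ^ (γ / η) < 1) :
    ∫⁻ ω, ENNReal.ofReal (Real.exp (γ * M (ℓ₀ ω) ω)) ∂P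
      ≤ ENNReal.ofReal (K ^ (γ / η) / (1 - q ^ (1 - γ / η) * c ^ (γ / η))) := by
  obtain ⟨hq0, hq1⟩ := hq
  set θ := γ / η with hθ
  have hθ0 : 0 < θ := div_pos hγ hη
  have hθ1 : θ < 1 := (div_lt_one hη).2 hγη
  have h1θ : 0 < 1 - θ := by linarith
  have hηθ : η * θ = γ := by rw [hθ]; field_simp
  set ρ := q ^ (1 - θ) * c ^ θ with hρdef
  have hρ0 : 0 < ρ := by positivity
  let f : ℕ → Ω → ENNReal := fun l ω => ENNReal.ofReal (Real.exp (η * M l ω))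
  let g : ℕ → Ω → ENNReal := fun l => Set.indicator {ω | ℓ₀ ω = l} (fun _ => 1)
  have hset : ∀ l, MeasurableSet {ω | ℓ₀ ω = l} := fun l =>
    hℓ₀meas (measurableSet_singleton l)
  have hf : ∀ l, Measurable (f l) := fun l => by
    have := hMmeas l
    fun_prop
  have hg : ∀ l, Measurable (g l) := fun l => measurable_const.indicator (hset l)
  have hpt : ∀ ω, ENNReal.ofReal (Real.exp (γ * M (ℓ₀ ω) ω))
      ≤ ∑' l, f l ω ^ θ * g l ω ^ (1 - θ) := by
    intro ω
    refine le_trans (le_of_eq ?_) (ENNReal.le_tsum (ℓ₀ ω))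
    have h1 : g (ℓ₀ ω) ω = 1 := by simp [g]
    rw [h1, ENNReal.one_rpow, mul_one]
    simp only [f]
    rw [ENNReal.ofReal_rpow_of_pos (Real.exp_pos _), ← Real.exp_mul]
    congr 2
    rw [← hηθ]; ring
  have hterm : ∀ l, ∫⁻ ω, f l ω ^ θ * g l ω ^ (1 - θ) ∂P
      ≤ ENNReal.ofReal (K ^ θ * ρ ^ l) := by
    intro l
    refine (ENNReal.lintegral_mul_norm_pow_le (hf l).aemeasurable (hg l).aemeasurable
      hθ0.le h1θ.le (by ring)).trans ?_
    have hgl : ∫⁻ ω, g l ω ∂P ≤ ENNReal.ofReal (q ^ l) := by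
      simp only [g]
      rw [lintegral_indicator (hset l)]
      simp only [lintegral_const, one_mul, Measure.restrict_apply_univ]
      refine (measure_mono ?_).trans (hℓ₀tail l)
      intro ω hω
      exact (Eq.symm hω).le
    calc (∫⁻ ω, f l ω ∂P) ^ θ * (∫⁻ ω, g l ω ∂P) ^ (1 - θ)
        ≤ ENNReal.ofReal (K * c ^ l) ^ θ * ENNReal.ofReal (q ^ l) ^ (1 - θ) :=
          mul_le_mul' (ENNReal.rpow_le_rpow (hMexp l) hθ0.le)
            (ENNReal.rpow_le_rpow hgl h1θ.le)
      _ = ENNReal.ofReal (K ^ θ * ρ ^ l) := by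
          rw [ENNReal.ofReal_rpow_of_pos (by positivity),
            ENNReal.ofReal_rpow_of_pos (by positivity), ← ENNReal.ofReal_mul (by positivity)]
          congr 1
          rw [Real.mul_rpow hK.le (by positivity), hρdef, mul_pow,
            ← Real.rpow_natCast_mul hc.le, ← Real.rpow_natCast_mul hq0.le,
            ← Real.rpow_mul_natCast hc.le, ← Real.rpow_mul_natCast hq0.le,
            mul_comm (l : ℝ) θ, mul_comm (l : ℝ) (1 - θ)]
          ring
  calc ∫⁻ ω, ENNReal.ofReal (Real.exp (γ * M (ℓ₀ ω) ω)) ∂P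
      ≤ ∫⁻ ω, ∑' l, f l ω ^ θ * g l ω ^ (1 - θ) ∂P := lintegral_mono hpt
    _ = ∑' l, ∫⁻ ω, f l ω ^ θ * g l ω ^ (1 - θ) ∂P :=
        lintegral_tsum fun l => (((hf l).pow_const θ).mul ((hg l).pow_const (1 - θ))).aemeasurable
    _ ≤ ∑' l, ENNReal.ofReal (K ^ θ * ρ ^ l) := ENNReal.tsum_le_tsum hterm
    _ = ENNReal.ofReal (K ^ θ / (1 - ρ)) := by
        rw [← ENNReal.ofReal_tsum_of_nonneg (fun l => by positivity)
          ((summable_geometric_of_lt_one hρ0.le hρ).mul_left _), tsum_mul_left,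
          tsum_geometric_of_lt_one hρ0.le hρ, div_eq_mul_inv]
end
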